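/- (Theorem 3.4, Foster–Lyapunov equation under positive abandonment, Poisson arrivals) Let sequences λᵢⁿ, μᵢⁿ, γᵢⁿ > 0 (i = 1,…,m, n ∈ ℕ) satisfy the Halfin–Whitt limits: λᵢⁿ/n → λᵢ > 0, μᵢⁿ → μᵢ > 0, γᵢⁿ → γᵢ, (λᵢⁿ − nλᵢ)/√n → λ̂ᵢ, √n(μᵢⁿ − μᵢ) → μ̂ᵢ, Σᵢλᵢ/μᵢ = 1, and liminf_{n→∞} γᵢⁿ > 0 for all i. Set βᵢⁿ := γᵢⁿ/μᵢⁿ and θⁿ := 1 ∧ (((1−βⁿ_min)∨(1/2))/βⁿ_max). Then for every η > 0 there exist positive constants κ̆₀(η), κ̆₁(η) and N ∈ ℕ such that for all n ≥ N the function V̆ⁿ(x) := exp(ηθⁿΨⁿ(−x̂ⁿ(x)) + ηΨⁿ(x̂ⁿ(x))) satisfies 𝒜ⁿ_z V̆ⁿ(x) ≤ κ̆₀(η) − κ̆₁(η)·‖x̂ⁿ(x)‖₁·V̆ⁿ(x) for all x ∈ ℤ₊^m and all z ∈ 𝒵ⁿ(x). -/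

import Mathlib

open scoped BigOperators

/-- The piecewise function ψ. -/
noncomputable def psiFn (t : ℝ) : ℝ :=
  if t ≤ -1 then -(1/2)
  else if t ≤ 0 then (t+1)^3 - (1/2)*(t+1)^4 - 1/2
  else t

/-- ψ_ε(t) := ψ(εt). -/
noncomputable def psiE (ε t : ℝ) : ℝ := psiFn (ε * t)

/-- Ψ(y) := Σᵢ ψ(yᵢ)/μᵢ. -/
noncomputable def bigPsi {m : ℕ} (μ : Fin m → ℝ) (x : Fin m → ℝ) : ℝ :=
  ∑ i, psiFn (x i) / μ i

/-- Ψ_ε(y) := Σᵢ ψ_ε(yᵢ)/μᵢ. -/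
noncomputable def bigPsiE {m : ℕ} (μ : Fin m → ℝ) (ε : ℝ) (x : Fin m → ℝ) : ℝ :=
  ∑ i, psiE ε (x i) / μ i

/-- ‖x‖₁ = Σᵢ|xᵢ|. -/
noncomputable def norm1 {m : ℕ} (x : Fin m → ℝ) : ℝ := ∑ i, |x i|

/-- The spare-capacity parameter ρⁿ = √n(1 − Σᵢλᵢⁿ/(nμᵢⁿ)). -/
noncomputable def rhoN {m : ℕ} (n : ℕ) (lam μ : Fin m → ℝ) : ℝ :=
  Real.sqrt n * (1 - ∑ i, lam i / (n * μ i))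

/-- The diffusion scaling x̂ⁿ(x)ᵢ = (xᵢ − λᵢⁿ/μᵢⁿ)/√n − ρⁿ/m. -/
noncomputable def hatX {m : ℕ} (n : ℕ) (lam μ : Fin m → ℝ) (x : Fin m → ℕ) :
    Fin m → ℝ :=
  fun i => ((x i : ℝ) - lam i / μ i) / Real.sqrt n - rhoN n lam μ / m

/-- The set of work-conserving allocations 𝒵ⁿ(x). -/
def workCons {m : ℕ} (n : ℕ) (x : Fin m → ℕ) : Set (Fin m → ℕ) :=
  {z | (∀ i, z i ≤ x i) ∧ ∑ i, z i = min n (∑ i, x i)}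

/-- The generator of the n-server system with Poisson arrivals under allocation z. -/
noncomputable def genN {m : ℕ} (lam μ γ : Fin m → ℝ) (z : Fin m → ℕ)
    (f : (Fin m → ℕ) → ℝ) (x : Fin m → ℕ) : ℝ :=
  ∑ i, lam i * (f (x + Pi.single i 1) - f x)
    + ∑ i, (μ i * (z i : ℝ) + γ i * ((x i : ℝ) - (z i : ℝ)))
        * (f (x - Pi.single i 1) - f x)

/-- The derivative of `psiFn`. -/
noncomputable def psiDeriv (t : ℝ) : ℝ :=
  if t ≤ -1 then 0
  else if t ≤ 0 then 3 * (t+1)^2 - 2 * (t+1)^3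
  else 1

lemma psiDeriv_nonneg (t : ℝ) : 0 ≤ psiDeriv t := by
  unfold psiDeriv
  split_ifs with h h'
  · exact le_rfl
  · push Not at h
    nlinarith [mul_nonneg (sq_nonneg (t+1)) (by linarith : (0:ℝ) ≤ 1 - 2 * t)]
  · exact zero_le_one

lemma psiDeriv_le_one (t : ℝ) : psiDeriv t ≤ 1 := by
  unfold psiDeriv
  split_ifs with h h'
  · exact zero_le_one
  · push Not at h
    nlinarith [mul_nonneg (sq_nonneg t) (by linarith : (0:ℝ) ≤ 2 * (t + 1) + 1)]
  · exact le_rfl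

lemma psiDeriv_of_le {t : ℝ} (h : t ≤ -1) : psiDeriv t = 0 := by simp [psiDeriv, h]

lemma psiDeriv_of_nonneg {t : ℝ} (h : 0 ≤ t) : psiDeriv t = 1 := by
  unfold psiDeriv
  split_ifs with h1 h2
  · linarith
  · obtain rfl : t = 0 := le_antisymm h2 h
    norm_num
  · rfl

lemma psiFn_of_nonneg {t : ℝ} (h : 0 ≤ t) : psiFn t = t := by
  unfold psiFn
  split_ifs with h1 h2
  · linarith
  · obtain rfl : t = 0 := le_antisymm h2 h
    norm_num
  · rfl

lemma hasDerivAt_psiPoly (t : ℝ) :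
    HasDerivAt (fun t : ℝ => (t+1)^3 - (1/2)*(t+1)^4 - 1/2) (3 * (t+1)^2 - 2 * (t+1)^3) t := by
  have h : HasDerivAt (fun t : ℝ => t + 1) 1 t := (hasDerivAt_id t).add_const 1
  refine (((h.pow 3).sub ((h.pow 4).const_mul (1/2))).sub_const (1/2)).congr_deriv ?_
  norm_num
  ring

/-- Two differentiable pieces agreeing to first order at the point `a` glue to a function
differentiable at `a`. -/
lemma hasDerivAt_of_eq_left_right {f g h : ℝ → ℝ} {a b c d : ℝ} (hb : b < a) (hc : a < c)
    (hg : HasDerivAt g d a) (hh : HasDerivAt h d a)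
    (hfg : ∀ t, b < t → t ≤ a → f t = g t) (hfh : ∀ t, a ≤ t → t < c → f t = h t) :
    HasDerivAt f d a := by
  have h1 : HasDerivWithinAt f d (Set.Iic a) a :=
    hg.hasDerivWithinAt.congr_of_eventuallyEq
      (by filter_upwards [self_mem_nhdsWithin, mem_nhdsWithin_of_mem_nhds (Ioi_mem_nhds hb)]
            with t ht ht' using hfg t ht' ht) (hfg a hb le_rfl)
  have h2 : HasDerivWithinAt f d (Set.Ici a) a :=
    hh.hasDerivWithinAt.congr_of_eventuallyEq
      (by filter_upwards [self_mem_nhdsWithin, mem_nhdsWithin_of_mem_nhds (Iio_mem_nhds hc)]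
            with t ht ht' using hfh t ht ht') (hfh a le_rfl hc)
  simpa [hasDerivWithinAt_univ, Set.Iic_union_Ici] using h1.union h2

lemma psiFn_of_le {t : ℝ} (h : t ≤ -1) : psiFn t = -(1/2) := by simp [psiFn, h]

lemma psiFn_of_mem {t : ℝ} (h : -1 ≤ t) (h' : t ≤ 0) :
    psiFn t = (t+1)^3 - (1/2)*(t+1)^4 - 1/2 := by
  unfold psiFn
  split_ifs with h1
  · obtain rfl : t = -1 := le_antisymm h1 h
    norm_num
  · rfl

lemma psiDeriv_of_mem {t : ℝ} (h : -1 ≤ t) (h' : t ≤ 0) :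
    psiDeriv t = 3 * (t+1)^2 - 2 * (t+1)^3 := by
  unfold psiDeriv
  split_ifs with h1
  · obtain rfl : t = -1 := le_antisymm h1 h
    norm_num
  · rfl

lemma hasDerivAt_psiFn (t : ℝ) : HasDerivAt psiFn (psiDeriv t) t := by
  rcases lt_trichotomy t (-1) with h | rfl | h
  · rw [psiDeriv_of_le h.le]
    exact hasDerivAt_of_eq_left_right (b := t - 1) (by linarith) h
      (hasDerivAt_const t (-(1/2))) (hasDerivAt_const t (-(1/2)))
      (fun s _ hs => psiFn_of_le (by linarith)) (fun s _ hs => psiFn_of_le hs.le)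
  · refine hasDerivAt_of_eq_left_right (b := -2) (c := 0) (by norm_num) (by norm_num)
      (g := fun _ => -(1/2)) ?_ (hasDerivAt_psiPoly (-1)|>.congr_deriv ?_)
      (fun s _ hs => psiFn_of_le hs) (fun s hs hs' => psiFn_of_mem hs hs'.le)
    · rw [psiDeriv_of_le le_rfl]
      exact hasDerivAt_const _ _
    · rw [psiDeriv_of_le le_rfl]
      norm_num
  · rcases lt_trichotomy t 0 with h' | rfl | h'
    · rw [psiDeriv_of_mem h.le h'.le]
      exact hasDerivAt_of_eq_left_right h h' (hasDerivAt_psiPoly t) (hasDerivAt_psiPoly t)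
        (fun s hs hs' => psiFn_of_mem hs.le (by linarith))
        (fun s hs hs' => psiFn_of_mem (by linarith) hs'.le)
    · refine hasDerivAt_of_eq_left_right (b := -1) (c := 1) (by norm_num) (by norm_num)
        (h := fun s => s) (hasDerivAt_psiPoly 0|>.congr_deriv ?_) ?_
        (fun s hs hs' => psiFn_of_mem hs.le hs') (fun s hs hs' => psiFn_of_nonneg hs)
      · rw [psiDeriv_of_nonneg le_rfl]
        norm_num
      · rw [psiDeriv_of_nonneg le_rfl]
        exact hasDerivAt_id _
    · rw [psiDeriv_of_nonneg h'.le]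
      exact hasDerivAt_of_eq_left_right (c := t + 1) h' (by linarith) (hasDerivAt_id t)
        (hasDerivAt_id t) (fun s hs hs' => psiFn_of_nonneg hs.le)
        (fun s hs hs' => psiFn_of_nonneg (by linarith))

lemma psiDeriv_eq_clamp (t : ℝ) :
    psiDeriv t = 3 * (max 0 (min 1 (t+1)))^2 - 2 * (max 0 (min 1 (t+1)))^3 := by
  rcases le_total t (-1) with h | h
  · rw [psiDeriv_of_le h, min_eq_right (by linarith), max_eq_left (by linarith)]
    norm_num
  rcases le_total t 0 with h' | h'
  · rw [psiDeriv_of_mem h h', min_eq_right (by linarith), max_eq_right (by linarith)]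
  · rw [psiDeriv_of_nonneg h', min_eq_left (by linarith), max_eq_right (by linarith)]
    norm_num

lemma abs_smoothstep_sub_le {u v : ℝ} (hu : 0 ≤ u) (hu1 : u ≤ 1) (hv : 0 ≤ v) (hv1 : v ≤ 1) :
    |(3 * u^2 - 2 * u^3) - (3 * v^2 - 2 * v^3)| ≤ 2 * |u - v| := by
  have e : (3 * u^2 - 2 * u^3) - (3 * v^2 - 2 * v^3)
      = (3 * (u + v) - 2 * (u^2 + u*v + v^2)) * (u - v) := by ring
  rw [e, abs_mul]
  refine mul_le_mul_of_nonneg_right (abs_le.2 ⟨?_, ?_⟩) (abs_nonneg _)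
  · nlinarith [mul_nonneg hu hv, mul_nonneg hu (sub_nonneg.2 hu1),
      mul_nonneg hv (sub_nonneg.2 hv1), mul_nonneg hu (sub_nonneg.2 hv1)]
  · nlinarith [sq_nonneg (u - v), sq_nonneg (u + v - 1)]

lemma abs_psiDeriv_sub_le (s t : ℝ) : |psiDeriv s - psiDeriv t| ≤ 2 * |s - t| := by
  rw [psiDeriv_eq_clamp s, psiDeriv_eq_clamp t]
  refine (abs_smoothstep_sub_le (le_max_left _ _) (max_le zero_le_one (min_le_left _ _))
    (le_max_left _ _) (max_le zero_le_one (min_le_left _ _))).trans ?_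
  refine mul_le_mul_of_nonneg_left ?_ zero_le_two
  have h1 := abs_max_sub_max_le_max 0 (min 1 (s+1)) 0 (min 1 (t+1))
  have h2 := abs_min_sub_min_le_max 1 (s+1) 1 (t+1)
  simp only [sub_self, abs_zero, add_sub_add_right_eq_sub] at h1 h2
  rw [max_eq_right (abs_nonneg (min 1 (s+1) - min 1 (t+1)))] at h1
  rw [max_eq_right (abs_nonneg (s - t))] at h2
  exact h1.trans h2

lemma exists_psiFn_sub_eq (a b : ℝ) :
    ∃ c, |c - a| ≤ |b - a| ∧ psiFn b - psiFn a = psiDeriv c * (b - a) := by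
  have hc : Continuous psiFn :=
    continuous_iff_continuousAt.2 fun t => (hasDerivAt_psiFn t).continuousAt
  rcases lt_trichotomy a b with h | rfl | h
  · obtain ⟨c, ⟨h1, h2⟩, h3⟩ := exists_hasDerivAt_eq_slope psiFn psiDeriv h hc.continuousOn
      fun t _ => hasDerivAt_psiFn t
    refine ⟨c, ?_, ?_⟩
    · rw [abs_of_pos (by linarith), abs_of_pos (by linarith)]
      linarith
    · rw [h3, div_mul_cancel₀ _ (by linarith)]
  · exact ⟨a, by simp, by simp⟩
  · obtain ⟨c, ⟨h1, h2⟩, h3⟩ := exists_hasDerivAt_eq_slope psiFn psiDeriv h hc.continuousOn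
      fun t _ => hasDerivAt_psiFn t
    refine ⟨c, ?_, ?_⟩
    · rw [abs_of_neg (by linarith), abs_of_neg (by linarith)]
      linarith
    · rw [h3, div_mul_eq_mul_div, eq_div_iff (by linarith)]
      ring

lemma abs_psiFn_sub_le (a b : ℝ) : |psiFn b - psiFn a| ≤ |b - a| := by
  obtain ⟨c, -, h⟩ := exists_psiFn_sub_eq a b
  rw [h, abs_mul, abs_of_nonneg (psiDeriv_nonneg c)]
  exact mul_le_of_le_one_left (abs_nonneg _) (psiDeriv_le_one c)

lemma psiFn_le_abs (t : ℝ) : psiFn t ≤ |t| := by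
  simpa [psiFn_of_nonneg le_rfl] using (le_abs_self _).trans (abs_psiFn_sub_le 0 t)

lemma psiFn_sub_le_quadratic (a b : ℝ) :
    psiFn b - psiFn a ≤ psiDeriv a * (b - a) + 2 * (b - a)^2 := by
  obtain ⟨c, h1, h2⟩ := exists_psiFn_sub_eq a b
  have h3 := mul_le_mul (abs_psiDeriv_sub_le c a) le_rfl (abs_nonneg (b - a)) (by positivity)
  rw [← abs_mul] at h3
  nlinarith [le_abs_self ((psiDeriv c - psiDeriv a) * (b - a)), sq_abs (b - a),
    mul_le_mul_of_nonneg_right h1 (abs_nonneg (b - a))]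

/-- The contribution of a single class to the exponent of the Lyapunov function. -/
noncomputable def lyapTerm (η θ μ t : ℝ) : ℝ := η * θ * (psiFn (-t) / μ) + η * (psiFn t / μ)

/-- The derivative of `lyapTerm` up to the factor `η / μ`. -/
noncomputable def lyapSlope (θ t : ℝ) : ℝ := psiDeriv t - θ * psiDeriv (-t)

lemma bigPsi_add_eq_sum_lyapTerm {m : ℕ} (η θ : ℝ) (μ y : Fin m → ℝ) :
    η * θ * bigPsi μ (-y) + η * bigPsi μ y = ∑ i, lyapTerm η θ (μ i) (y i) := by
  simp only [bigPsi, lyapTerm, Finset.mul_sum, Finset.sum_add_distrib, Pi.neg_apply]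

section OneDim

variable {η θ μ : ℝ}

lemma lyapTerm_eq (t : ℝ) : lyapTerm η θ μ t = η / μ * (θ * psiFn (-t) + psiFn t) := by
  unfold lyapTerm
  ring

lemma lyapTerm_le (hη : 0 < η) (hμ : 0 < μ) (h0 : 0 ≤ θ) (h1 : θ ≤ 1) (t : ℝ) :
    lyapTerm η θ μ t ≤ 2 * η / μ * |t| := by
  have h : θ * psiFn (-t) + psiFn t ≤ 2 * |t| := by
    have h2 := psiFn_le_abs (-t)
    rw [abs_neg] at h2
    nlinarith [mul_le_mul_of_nonneg_left h2 h0, mul_le_mul_of_nonneg_right h1 (abs_nonneg t),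
      psiFn_le_abs t]
  rw [lyapTerm_eq]
  refine (mul_le_mul_of_nonneg_left h (by positivity)).trans_eq ?_
  ring

lemma abs_lyapTerm_sub_le (hη : 0 < η) (hμ : 0 < μ) (h0 : 0 ≤ θ) (h1 : θ ≤ 1) (a b : ℝ) :
    |lyapTerm η θ μ b - lyapTerm η θ μ a| ≤ 2 * η / μ * |b - a| := by
  have h : |θ * (psiFn (-b) - psiFn (-a)) + (psiFn b - psiFn a)| ≤ 2 * |b - a| := by
    have h2 := abs_psiFn_sub_le (-a) (-b)
    rw [show -b - -a = -(b - a) by ring, abs_neg] at h2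
    have h3 := abs_psiFn_sub_le a b
    refine (abs_add_le _ _).trans ?_
    rw [abs_mul, abs_of_nonneg h0]
    nlinarith [mul_le_mul_of_nonneg_left h2 h0, mul_le_mul_of_nonneg_right h1 (abs_nonneg (b-a))]
  have e : lyapTerm η θ μ b - lyapTerm η θ μ a
      = η / μ * (θ * (psiFn (-b) - psiFn (-a)) + (psiFn b - psiFn a)) := by
    rw [lyapTerm_eq, lyapTerm_eq]
    ring
  rw [e, abs_mul, abs_of_pos (by positivity)]
  refine (mul_le_mul_of_nonneg_left h (by positivity)).trans_eq ?_
  ring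

lemma lyapTerm_sub_le_quadratic (hη : 0 < η) (hμ : 0 < μ) (h0 : 0 ≤ θ) (h1 : θ ≤ 1) (a d : ℝ) :
    lyapTerm η θ μ (a + d) - lyapTerm η θ μ a
      ≤ η / μ * lyapSlope θ a * d + 4 * η / μ * d^2 := by
  have h : θ * (psiFn (-(a+d)) - psiFn (-a)) + (psiFn (a+d) - psiFn a)
      ≤ lyapSlope θ a * d + 4 * d^2 := by
    have h2 := psiFn_sub_le_quadratic (-a) (-(a+d))
    have h3 := psiFn_sub_le_quadratic a (a+d)
    unfold lyapSlope
    nlinarith [mul_le_mul_of_nonneg_left h2 h0, mul_le_mul_of_nonneg_right h1 (sq_nonneg d)]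
  have e : lyapTerm η θ μ (a+d) - lyapTerm η θ μ a
      = η / μ * (θ * (psiFn (-(a+d)) - psiFn (-a)) + (psiFn (a+d) - psiFn a)) := by
    rw [lyapTerm_eq, lyapTerm_eq]
    ring
  rw [e]
  refine (mul_le_mul_of_nonneg_left h (by positivity)).trans_eq ?_
  ring

lemma exp_lyapTerm_sub_le {a : ℝ} (hη : 0 < η) (ha : 0 < a) (hμ : a ≤ μ) (h0 : 0 ≤ θ)
    (h1 : θ ≤ 1) (t d : ℝ) (hd : 2 * η / a * |d| ≤ 1) :
    Real.exp (lyapTerm η θ μ (t + d) - lyapTerm η θ μ t) - 1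
      ≤ η / μ * lyapSlope θ t * d + (4 * η / a + (2 * η / a)^2) * d^2 := by
  have hμ0 : 0 < μ := ha.trans_le hμ
  set u := lyapTerm η θ μ (t + d) - lyapTerm η θ μ t with hu
  have h2 : |u| ≤ 2 * η / a * |d| := by
    have h := abs_lyapTerm_sub_le hη hμ0 h0 h1 t (t + d)
    rw [add_sub_cancel_left] at h
    exact h.trans (by gcongr)
  have h3 : u ≤ η / μ * lyapSlope θ t * d + 4 * η / a * d^2 :=
    (lyapTerm_sub_le_quadratic hη hμ0 h0 h1 t d).trans (by gcongr)
  have h4 := (abs_le.1 (Real.abs_exp_sub_one_sub_id_le (h2.trans hd))).2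
  have h5 : u^2 ≤ (2 * η / a)^2 * d^2 := by
    rw [← sq_abs u, ← sq_abs d, ← mul_pow]
    exact pow_le_pow_left₀ (abs_nonneg u) h2 2
  linarith

lemma lyapSlope_le_one (h0 : 0 ≤ θ) (t : ℝ) : lyapSlope θ t ≤ 1 := by
  have := mul_nonneg h0 (psiDeriv_nonneg (-t))
  have := psiDeriv_le_one t
  unfold lyapSlope
  linarith

lemma neg_le_lyapSlope (h0 : 0 ≤ θ) (t : ℝ) : -θ ≤ lyapSlope θ t := by
  have := mul_le_mul_of_nonneg_left (psiDeriv_le_one (-t)) h0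
  have := psiDeriv_nonneg t
  unfold lyapSlope
  linarith

lemma lyapSlope_mul_ge (h0 : 0 ≤ θ) (h1 : θ ≤ 1) (t : ℝ) :
    max t 0 + θ * max (-t) 0 - 2 ≤ lyapSlope θ t * t := by
  have hs1 := lyapSlope_le_one h0 t
  have hs2 := neg_le_lyapSlope h0 t
  rcases le_total 1 t with h | h
  · rw [max_eq_left (by linarith), max_eq_right (by linarith), lyapSlope,
      psiDeriv_of_nonneg (by linarith), psiDeriv_of_le (by linarith)]
    linarith
  rcases le_total t (-1) with h' | h'
  · rw [max_eq_right (by linarith), max_eq_left (by linarith), lyapSlope,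
      psiDeriv_of_le h', psiDeriv_of_nonneg (by linarith)]
    linarith
  · have h3 : |lyapSlope θ t * t| ≤ 1 := by
      rw [abs_mul]
      exact mul_le_one₀ (abs_le.2 ⟨by linarith, hs1⟩) (abs_nonneg _) (abs_le.2 ⟨h', h⟩)
    have h4 : max t 0 + θ * max (-t) 0 ≤ 1 := by
      rcases le_total t 0 with h5 | h5
      · rw [max_eq_right h5, max_eq_left (by linarith)]
        nlinarith
      · rw [max_eq_left h5, max_eq_right (by linarith)]
        linarith
    linarith [(abs_le.1 h3).1]

lemma lyapSlope_mul_one_sub_le {β c : ℝ} (h0 : 0 ≤ θ) (hβ : 0 ≤ β) (hc : 0 ≤ c)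
    (h1 : 1 - β ≤ c) (h2 : θ * β ≤ c) (t : ℝ) : lyapSlope θ t * (1 - β) ≤ c := by
  have hs1 := lyapSlope_le_one h0 t
  have hs2 := neg_le_lyapSlope h0 t
  rcases le_total 0 (lyapSlope θ t) with h | h
  · nlinarith [mul_le_mul_of_nonneg_left h1 h, mul_le_mul_of_nonneg_right hs1 hc]
  · nlinarith [mul_le_mul_of_nonneg_right hs2 hβ]

end OneDim

section HatX

variable {m n : ℕ} {lam μ : Fin m → ℝ} {x : Fin m → ℕ}

lemma hatX_add_single (i : Fin m) :
    hatX n lam μ (x + Pi.single i 1)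
      = Function.update (hatX n lam μ x) i (hatX n lam μ x i + 1 / Real.sqrt n) := by
  ext j
  rcases eq_or_ne j i with rfl | h
  · simp [hatX]
    ring
  · simp [hatX, h]

lemma hatX_sub_single (i : Fin m) (hx : x i ≠ 0) :
    hatX n lam μ (x - Pi.single i 1)
      = Function.update (hatX n lam μ x) i (hatX n lam μ x i + -(1 / Real.sqrt n)) := by
  ext j
  rcases eq_or_ne j i with rfl | h
  · simp [hatX, Nat.cast_sub (Nat.one_le_iff_ne_zero.2 hx)]
    ring
  · simp [hatX, h]

lemma sum_hatX (hm : 1 ≤ m) (hn : 1 ≤ n) (hμ : ∀ i, 0 < μ i) :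
    ∑ i, hatX n lam μ x i = (∑ i, (x i : ℝ) - n) / Real.sqrt n := by
  have hm' : (m : ℝ) ≠ 0 := by positivity
  have hn' : (0 : ℝ) < n := by positivity
  have hs : Real.sqrt n ≠ 0 := by positivity
  have h1 : ∑ i, lam i / (n * μ i) = (∑ i, lam i / μ i) / n := by
    rw [Finset.sum_div]
    refine Finset.sum_congr rfl fun i _ => ?_
    have := (hμ i).ne'
    field_simp
  simp only [hatX, rhoN, Finset.sum_sub_distrib, ← Finset.sum_div, Finset.sum_const,
    Finset.card_univ, Fintype.card_fin, nsmul_eq_mul, h1]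
  have h2 : Real.sqrt n ^ 2 = n := Real.sq_sqrt hn'.le
  field_simp
  rw [h2]
  field_simp
  ring

lemma sum_update_sub {φ : Fin m → ℝ → ℝ} (y : Fin m → ℝ) (i : Fin m) (t : ℝ) :
    ∑ j, φ j (Function.update y i t j) - ∑ j, φ j (y j) = φ i t - φ i (y i) := by
  rw [← Finset.sum_sub_distrib, Finset.sum_eq_single i]
  · simp
  · intro j _ h
    simp [h]
  · simp

end HatX

lemma class_drift_le {η θ c a A K δ lam μ γ x z y r : ℝ} (hη : 0 < η) (h0 : 0 ≤ θ) (h1 : θ ≤ 1)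
    (hc : 0 ≤ c) (ha : 0 < a) (hμa : a ≤ μ) (hμA : μ ≤ A) (hγ : 0 < γ) (hγA : γ ≤ A)
    (hβ1 : 1 - γ / μ ≤ c) (hβ2 : θ * (γ / μ) ≤ c) (hK : 0 ≤ K) (hδ : 0 < δ) (hδ1 : δ ≤ 1)
    (hlamA : lam * δ^2 ≤ A) (hz : 0 ≤ z) (hzx : z ≤ x) (hr : |r| ≤ A)
    (hy : y = (x - lam / μ) * δ - r) :
    lam * (η / μ * lyapSlope θ y * δ + K * δ^2)
        + (μ * z + γ * (x - z)) * (η / μ * lyapSlope θ y * (-δ) + K * δ^2)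
      ≤ η * (-(max y 0 + θ * max (-y) 0) + 2 + A + c * ((x - z) * δ))
        + K * (A + A * (δ * |y| + A + A / a)) := by
  have hμ : 0 < μ := ha.trans_le hμa
  have hA : 0 < A := hμ.trans_le hμA
  set g := lyapSlope θ y with hg
  have hrate : (lam - (μ * z + γ * (x - z))) * δ / μ
      = -(y + r) + (1 - γ / μ) * ((x - z) * δ) := by
    rw [hy]
    field_simp
    ring
  have hfirst : g * ((lam - (μ * z + γ * (x - z))) * δ / μ)
      ≤ -(max y 0 + θ * max (-y) 0) + 2 + A + c * ((x - z) * δ) := by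
    have e1 := lyapSlope_mul_ge h0 h1 y
    have e2 : |g * r| ≤ A := by
      rw [abs_mul]
      have : |g| ≤ 1 :=
        abs_le.2 ⟨by linarith [neg_le_lyapSlope h0 y], lyapSlope_le_one h0 y⟩
      exact (mul_le_of_le_one_left (abs_nonneg r) this).trans hr
    have e3 := mul_le_mul_of_nonneg_right
      (lyapSlope_mul_one_sub_le h0 (div_pos hγ hμ).le hc hβ1 hβ2 y)
      (mul_nonneg (sub_nonneg.2 hzx) hδ.le)
    rw [hrate]
    linarith [(abs_le.1 e2).1]
  have hx : x * δ^2 ≤ δ * |y| + A + A / a := by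
    have e : x * δ^2 = δ * y + δ * r + lam * δ^2 / μ := by
      rw [hy]
      field_simp
      ring
    have e1 : lam * δ^2 / μ ≤ A / a := div_le_div₀ hA.le hlamA ha hμa
    have e2 : δ * r ≤ A :=
      (mul_le_mul_of_nonneg_left ((le_abs_self r).trans hr) hδ.le).trans
        (mul_le_of_le_one_left hA.le hδ1)
    have e3 := mul_le_mul_of_nonneg_left (le_abs_self y) hδ.le
    linarith
  have hrx : (μ * z + γ * (x - z)) * δ^2 ≤ A * (δ * |y| + A + A / a) := by
    have e : μ * z + γ * (x - z) ≤ A * x := by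
      nlinarith [mul_le_mul_of_nonneg_right hμA hz,
        mul_le_mul_of_nonneg_right hγA (sub_nonneg.2 hzx)]
    refine (mul_le_mul_of_nonneg_right e (sq_nonneg δ)).trans ?_
    rw [mul_assoc]
    exact mul_le_mul_of_nonneg_left hx hA.le
  have hsplit : lam * (η / μ * g * δ + K * δ^2)
        + (μ * z + γ * (x - z)) * (η / μ * g * (-δ) + K * δ^2)
      = η * (g * ((lam - (μ * z + γ * (x - z))) * δ / μ))
        + K * (lam * δ^2 + (μ * z + γ * (x - z)) * δ^2) := by
    field_simp
    ring
  rw [hsplit]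
  exact add_le_add (mul_le_mul_of_nonneg_left hfirst hη.le)
    (mul_le_mul_of_nonneg_left (add_le_add hlamA hrx) hK)

/-- The drift inequality for a single system, with explicit constants. -/
lemma genN_exp_le {m n : ℕ} (hm : 1 ≤ m) (hn : 1 ≤ n) {lam μ γ : Fin m → ℝ} {x z : Fin m → ℕ}
    {η θ c a A K κ : ℝ} (hη : 0 < η) (hθ1 : θ ≤ 1) (hc : 0 ≤ c) (ha : 0 < a)
    (hlam : ∀ i, 0 < lam i) (hμa : ∀ i, a ≤ μ i) (hμA : ∀ i, μ i ≤ A)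
    (hγ : ∀ i, 0 < γ i) (hγA : ∀ i, γ i ≤ A) (hlamA : ∀ i, lam i / n ≤ A)
    (hρ : |rhoN n lam μ| ≤ A) (hβ1 : ∀ i, 1 - γ i / μ i ≤ c) (hβ2 : ∀ i, θ * (γ i / μ i) ≤ c)
    (hκ : 0 < κ) (hκc : κ ≤ 1 - c) (hκθ : κ ≤ θ) (hK : K = 4 * η / a + (2 * η / a)^2)
    (hn1 : 2 * η / a * (1 / Real.sqrt n) ≤ 1)
    (hn2 : K * A * (1 / Real.sqrt n) ≤ η * κ / 2) (hz : z ∈ workCons n x) :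
    genN lam μ γ z (fun y => Real.exp (∑ i, lyapTerm η θ (μ i) (hatX n lam μ y i))) x
      ≤ Real.exp (∑ i, lyapTerm η θ (μ i) (hatX n lam μ x i))
        * (m * (η * (2 + A) + K * (A + A * (A + A / a)))
          - η * κ / 2 * norm1 (hatX n lam μ x)) := by
  have hμ : ∀ i, 0 < μ i := fun i => ha.trans_le (hμa i)
  have h0 : 0 ≤ θ := hκ.le.trans hκθ
  have hn' : (1 : ℝ) ≤ n := by exact_mod_cast hn
  have hK0 : 0 ≤ K := by
    rw [hK]
    positivity
  obtain ⟨hzx, hzsum⟩ := hz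
  set y := hatX n lam μ x with hy
  set δ := 1 / Real.sqrt n with hδ
  have hs : 0 < Real.sqrt n := by positivity
  have hδ0 : 0 < δ := by positivity
  have hδ1 : δ ≤ 1 := by
    rw [hδ, div_le_one hs]
    exact Real.one_le_sqrt.2 hn'
  have hδ2 : δ^2 = 1 / n := by
    rw [hδ, div_pow, Real.sq_sqrt (by positivity), one_pow]
  set V := Real.exp (∑ i, lyapTerm η θ (μ i) (y i)) with hV
  have hjump : ∀ (w : Fin m → ℕ) (i : Fin m) (d : ℝ), |d| = δ →
      hatX n lam μ w = Function.update y i (y i + d) →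
      Real.exp (∑ j, lyapTerm η θ (μ j) (hatX n lam μ w j)) - V
        ≤ V * (η / μ i * lyapSlope θ (y i) * d + K * δ^2) := by
    intro w i d hd hw
    have e1 := sum_update_sub (φ := fun j => lyapTerm η θ (μ j)) y i (y i + d)
    have e2 := exp_lyapTerm_sub_le hη ha (hμa i) h0 hθ1 (y i) d (hd ▸ hn1)
    rw [← hK, ← sq_abs d, hd] at e2
    rw [hw, sub_eq_iff_eq_add.1 e1, Real.exp_add, ← hV]
    have := mul_le_mul_of_nonneg_left e2 (Real.exp_pos _ : 0 < V).le
    linarith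
  have hgen : genN lam μ γ z (fun y => Real.exp (∑ i, lyapTerm η θ (μ i) (hatX n lam μ y i))) x
      ≤ V * ∑ i, (lam i * (η / μ i * lyapSlope θ (y i) * δ + K * δ^2)
        + (μ i * z i + γ i * (x i - z i)) *
          (η / μ i * lyapSlope θ (y i) * (-δ) + K * δ^2)) := by
    unfold genN
    rw [← Finset.sum_add_distrib, Finset.mul_sum]
    refine Finset.sum_le_sum fun i _ => ?_
    rw [mul_add, mul_left_comm V, mul_left_comm V]
    refine add_le_add (mul_le_mul_of_nonneg_left ?_ (hlam i).le) ?_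
    · exact hjump _ i δ (abs_of_pos hδ0) (hatX_add_single i)
    · rcases eq_or_ne (x i) 0 with hxi | hxi
      · have hzi : z i = 0 := Nat.le_zero.1 (hxi ▸ hzx i)
        simp [hxi, hzi]
      · refine mul_le_mul_of_nonneg_left ?_ ?_
        · exact hjump _ i (-δ) (by rw [abs_neg, abs_of_pos hδ0]) (hatX_sub_single i hxi)
        · have : (z i : ℝ) ≤ x i := by exact_mod_cast hzx i
          exact add_nonneg (mul_nonneg (hμ i).le (Nat.cast_nonneg _))
            (mul_nonneg (hγ i).le (sub_nonneg.2 this))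
  refine hgen.trans (mul_le_mul_of_nonneg_left ?_ (Real.exp_pos _).le)
  have hA : 0 ≤ A := (abs_nonneg _).trans hρ
  have hr : |rhoN n lam μ / m| ≤ A := by
    rw [abs_div, Nat.abs_cast]
    exact (div_le_self (abs_nonneg _) (by exact_mod_cast hm)).trans hρ
  have hqueue : ∑ i, ((x i : ℝ) - z i) * δ ≤ ∑ i, max (y i) 0 := by
    have e : ∑ i, ((x i : ℝ) - z i) * δ = max 0 (∑ i, y i) := by
      have e1 : (∑ i, (z i : ℝ)) = min (n : ℝ) (∑ i, (x i : ℝ)) := by exact_mod_cast hzsum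
      rw [← Finset.sum_mul, Finset.sum_sub_distrib, e1, hy, sum_hatX hm hn hμ, hδ]
      rcases le_total (n : ℝ) (∑ i, (x i : ℝ)) with h | h
      · rw [min_eq_left h, max_eq_right (div_nonneg (sub_nonneg.2 h) hs.le)]
        ring
      · rw [min_eq_right h, max_eq_left (div_nonpos_of_nonpos_of_nonneg (sub_nonpos.2 h) hs.le)]
        ring
    rw [e]
    exact max_le (Finset.sum_nonneg fun i _ => le_max_right _ _)
      (Finset.sum_le_sum fun i _ => le_max_left _ _)
  calc _ ≤ ∑ i, (η * (-(max (y i) 0 + θ * max (-y i) 0) + 2 + A + c * ((x i - z i) * δ))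
        + K * (A + A * (δ * |y i| + A + A / a))) := by
        refine Finset.sum_le_sum fun i _ => ?_
        refine class_drift_le hη h0 hθ1 hc ha (hμa i) (hμA i) (hγ i) (hγA i) (hβ1 i) (hβ2 i) hK0
          hδ0 hδ1 ?_ (Nat.cast_nonneg _) (by exact_mod_cast hzx i) hr ?_
        · rw [hδ2, mul_one_div]
          exact hlamA i
        · rw [hy, hatX, hδ]
          ring
    _ = ∑ i, (η * (-(max (y i) 0 + θ * max (-y i) 0) + 2 + A)
        + K * (A + A * (δ * |y i| + A + A / a))) + η * c * ∑ i, ((x i : ℝ) - z i) * δ := by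
        rw [Finset.mul_sum, ← Finset.sum_add_distrib]
        refine Finset.sum_congr rfl fun i _ => ?_
        ring
    _ ≤ ∑ i, (η * (-(max (y i) 0 + θ * max (-y i) 0) + 2 + A)
        + K * (A + A * (δ * |y i| + A + A / a))) + η * c * ∑ i, max (y i) 0 := by
        gcongr
    _ = ∑ i, (η * (-(max (y i) 0 + θ * max (-y i) 0) + 2 + A)
        + K * (A + A * (δ * |y i| + A + A / a)) + η * c * max (y i) 0) := by
        rw [Finset.mul_sum, ← Finset.sum_add_distrib]
    _ ≤ ∑ i, (η * (2 + A) + K * (A + A * (A + A / a)) - η * κ / 2 * |y i|) := by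
        refine Finset.sum_le_sum fun i _ => ?_
        have e1 : κ * |y i| ≤ (1 - c) * max (y i) 0 + θ * max (-y i) 0 := by
          rcases le_total (y i) 0 with h | h
          · rw [abs_of_nonpos h, max_eq_right h, max_eq_left (neg_nonneg.2 h)]
            nlinarith
          · rw [abs_of_nonneg h, max_eq_left h, max_eq_right (neg_nonpos.2 h)]
            nlinarith
        have e2 := mul_le_mul_of_nonneg_left e1 hη.le
        have e3 := mul_le_mul_of_nonneg_right hn2 (abs_nonneg (y i))
        linarith
    _ = _ := by
        rw [Finset.sum_sub_distrib, ← Finset.mul_sum, norm1]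
        simp [mul_add]

lemma exp_mul_sub_le {C k L E r : ℝ} (hC : 0 ≤ C) (hk : 0 < k) (hL : 0 ≤ L) (hr : 0 ≤ r) (hE : E ≤ L * r) :
    Real.exp E * (C - 2 * k * r) ≤ C * Real.exp (L * (C / k)) - k * r * Real.exp E := by
  suffices h : Real.exp E * (C - k * r) ≤ C * Real.exp (L * (C / k)) by linarith
  have hp := Real.exp_pos E
  rcases le_total (C / k) r with h | h
  · have h2 : C ≤ k * r := by
      rw [div_le_iff₀ hk] at h
      linarith
    exact (mul_nonpos_of_nonneg_of_nonpos hp.le (by linarith)).trans (by positivity)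
  · have h1 : Real.exp E ≤ Real.exp (L * (C / k)) :=
      Real.exp_le_exp.2 (hE.trans (mul_le_mul_of_nonneg_left h hL))
    nlinarith [mul_nonneg hp.le (mul_nonneg hk.le hr)]

section Asymptotics

open Filter Topology

lemma exists_eventually_forall_le {ι : Type*} [Fintype ι] {f : ℕ → ι → ℝ} {l : ι → ℝ}
    (h : ∀ i, Tendsto (fun n => f n i) atTop (𝓝 (l i))) :
    ∃ C > 0, ∀ᶠ n in atTop, ∀ i, f n i ≤ C := by
  refine ⟨∑ i, (|l i| + 1) + 1, by positivity, eventually_all.2 fun i => ?_⟩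
  have h1 : l i < ∑ i, (|l i| + 1) + 1 := by
    have := Finset.single_le_sum (f := fun i => |l i| + 1) (fun j _ => by positivity)
      (Finset.mem_univ i)
    linarith [le_abs_self (l i)]
  exact (h i).eventually (eventually_le_nhds h1)

lemma exists_eventually_forall_ge {ι : Type*} [Fintype ι] {f : ℕ → ι → ℝ} {l : ι → ℝ}
    (hl : ∀ i, 0 < l i) (h : ∀ i, Tendsto (fun n => f n i) atTop (𝓝 (l i))) :
    ∃ c > 0, ∀ᶠ n in atTop, ∀ i, c ≤ f n i := by
  obtain ⟨C, hC, hCe⟩ := exists_eventually_forall_le fun i => (h i).inv₀ (hl i).ne'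
  refine ⟨C⁻¹, inv_pos.2 hC, ?_⟩
  filter_upwards [hCe, eventually_all.2 fun i => (h i).eventually (lt_mem_nhds (hl i))]
    with n h1 h2 i
  exact inv_le_of_inv_le₀ (h2 i) (h1 i)

/-- The spare-capacity parameter converges in the Halfin–Whitt regime. -/
lemma tendsto_rhoN {m : ℕ} {lamN μN : ℕ → Fin m → ℝ} (hμN : ∀ n i, 0 < μN n i)
    {lam0 μ0 lamHat muHat : Fin m → ℝ} (hμ0 : ∀ i, 0 < μ0 i)
    (h2 : ∀ i, Tendsto (fun n => μN n i) atTop (𝓝 (μ0 i)))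
    (h4 : ∀ i, Tendsto (fun (n : ℕ) => (lamN n i - n * lam0 i) / Real.sqrt n) atTop
            (𝓝 (lamHat i)))
    (h5 : ∀ i, Tendsto (fun (n : ℕ) => Real.sqrt n * (μN n i - μ0 i)) atTop
            (𝓝 (muHat i)))
    (h6 : ∑ i, lam0 i / μ0 i = 1) :
    Tendsto (fun n => rhoN n (lamN n) (μN n)) atTop
      (𝓝 (∑ i, (lam0 i * muHat i - μ0 i * lamHat i) / (μ0 i * μ0 i))) := by
  have h : ∀ i, Tendsto (fun n : ℕ => (lam0 i * (Real.sqrt n * (μN n i - μ0 i))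
      - μ0 i * ((lamN n i - n * lam0 i) / Real.sqrt n)) / (μ0 i * μN n i)) atTop
      (𝓝 ((lam0 i * muHat i - μ0 i * lamHat i) / (μ0 i * μ0 i))) := fun i =>
    (((h5 i).const_mul _).sub ((h4 i).const_mul _)).div ((h2 i).const_mul _)
      (mul_pos (hμ0 i) (hμ0 i)).ne'
  refine (tendsto_finsetSum _ fun i _ => h i).congr' ?_
  filter_upwards [eventually_ge_atTop 1] with n hn
  rw [rhoN, ← h6, ← Finset.sum_sub_distrib, Finset.mul_sum]
  refine Finset.sum_congr rfl fun i _ => ?_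
  have hn' : (0 : ℝ) < n := by positivity
  have hs : Real.sqrt n ≠ 0 := by positivity
  have hsq : Real.sqrt n ^ 2 = n := Real.sq_sqrt hn'.le
  have := (hμN n i).ne'
  have := (hμ0 i).ne'
  field_simp
  rw [hsq]
  ring

end Asymptotics

open Filter in
/-- Theorem 3.4: under the Halfin–Whitt limits and
liminf γᵢⁿ > 0, for every η > 0 there are κ̆₀(η), κ̆₁(η) > 0 and N such that for
all n ≥ N, V̆ⁿ(x) = exp(ηθⁿΨⁿ(−x̂ⁿ(x)) + ηΨⁿ(x̂ⁿ(x))) satisfies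
𝒜ⁿ_z V̆ⁿ(x) ≤ κ̆₀ − κ̆₁‖x̂ⁿ(x)‖₁V̆ⁿ(x) for all x and all z ∈ 𝒵ⁿ(x). -/
theorem stmt16 {m : ℕ} (hm : 1 ≤ m)
    (lamN μN γN : ℕ → Fin m → ℝ)
    (hlamN : ∀ n i, 0 < lamN n i) (hμN : ∀ n i, 0 < μN n i) (hγN : ∀ n i, 0 < γN n i)
    (lam0 μ0 γ0 lamHat muHat : Fin m → ℝ)
    (hlam0 : ∀ i, 0 < lam0 i) (hμ0 : ∀ i, 0 < μ0 i)
    (h1 : ∀ i, Tendsto (fun (n : ℕ) => lamN n i / n) atTop (nhds (lam0 i)))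
    (h2 : ∀ i, Tendsto (fun n => μN n i) atTop (nhds (μ0 i)))
    (h3 : ∀ i, Tendsto (fun n => γN n i) atTop (nhds (γ0 i)))
    (h4 : ∀ i, Tendsto (fun (n : ℕ) => (lamN n i - n * lam0 i) / Real.sqrt n) atTop
            (nhds (lamHat i)))
    (h5 : ∀ i, Tendsto (fun (n : ℕ) => Real.sqrt n * (μN n i - μ0 i)) atTop
            (nhds (muHat i)))
    (h6 : ∑ i, lam0 i / μ0 i = 1)
    (h7 : ∀ i, 0 < Filter.liminf (fun n => γN n i) atTop)
    (βmaxN βminN : ℕ → ℝ)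
    (hβmax : ∀ n, IsGreatest (Set.range fun i => γN n i / μN n i) (βmaxN n))
    (hβmin : ∀ n, IsLeast (Set.range fun i => γN n i / μN n i) (βminN n)) :
    ∀ η : ℝ, 0 < η →
      ∃ κ₀ > (0:ℝ), ∃ κ₁ > (0:ℝ), ∃ N : ℕ, ∀ n : ℕ, N ≤ n →
        ∀ x : Fin m → ℕ, ∀ z ∈ workCons n x,
          genN (lamN n) (μN n) (γN n) z
              (fun y => Real.exp
                (η * min 1 (max (1 - βminN n) (1/2) / βmaxN n)
                    * bigPsi (μN n) (-(hatX n (lamN n) (μN n) y))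
                  + η * bigPsi (μN n) (hatX n (lamN n) (μN n) y))) x
            ≤ κ₀ - κ₁ * norm1 (hatX n (lamN n) (μN n) x)
                * Real.exp
                  (η * min 1 (max (1 - βminN n) (1/2) / βmaxN n)
                      * bigPsi (μN n) (-(hatX n (lamN n) (μN n) x))
                    + η * bigPsi (μN n) (hatX n (lamN n) (μN n) x)) := by
  intro η hη
  have : Nonempty (Fin m) := ⟨⟨0, hm⟩⟩
  have hγ0 : ∀ i, 0 < γ0 i := fun i => (h3 i).liminf_eq ▸ h7 i
  have hβ : ∀ i, Tendsto (fun n => γN n i / μN n i) atTop (nhds (γ0 i / μ0 i)) := fun i =>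
    (h3 i).div (h2 i) (hμ0 i).ne'
  obtain ⟨a, ha, hae⟩ := exists_eventually_forall_ge hμ0 h2
  obtain ⟨b, hb, hbe⟩ := exists_eventually_forall_ge (fun i => div_pos (hγ0 i) (hμ0 i)) hβ
  obtain ⟨B, hB, hBe⟩ := exists_eventually_forall_le hβ
  obtain ⟨A₁, hA₁, hA₁e⟩ := exists_eventually_forall_le h1
  obtain ⟨A₂, hA₂, hA₂e⟩ := exists_eventually_forall_le h2
  obtain ⟨A₃, hA₃, hA₃e⟩ := exists_eventually_forall_le h3
  obtain ⟨A₄, hA₄, hA₄e⟩ := exists_eventually_forall_le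
    fun _ : Unit => (tendsto_rhoN hμN hμ0 h2 h4 h5 h6).abs
  obtain ⟨A, hAdef⟩ : ∃ A, A = A₁ + A₂ + A₃ + A₄ := ⟨_, rfl⟩
  have hA : 0 < A := by
    rw [hAdef]
    positivity
  obtain ⟨c, hcdef⟩ : ∃ c : ℝ, c = max (1 - b) (1/2) := ⟨_, rfl⟩
  have hc0 : 0 ≤ c := by
    rw [hcdef]
    exact le_max_of_le_right (by norm_num)
  have hc1 : c < 1 := by
    rw [hcdef]
    exact max_lt (by linarith) (by norm_num)
  obtain ⟨κ, hκdef⟩ : ∃ κ : ℝ, κ = min (1 - c) (min 1 (1 / 2 / B)) := ⟨_, rfl⟩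
  have hκ : 0 < κ := by
    rw [hκdef]
    exact lt_min (by linarith) (lt_min one_pos (by positivity))
  obtain ⟨K, hK⟩ : ∃ K, K = 4 * η / a + (2 * η / a)^2 := ⟨_, rfl⟩
  have hKpos : 0 < K := by
    rw [hK]
    positivity
  have hδ : Tendsto (fun n : ℕ => 1 / Real.sqrt n) atTop (nhds 0) :=
    tendsto_const_nhds.div_atTop (Real.tendsto_sqrt_atTop.comp tendsto_natCast_atTop_atTop)
  have hδ1 : ∀ᶠ n : ℕ in atTop, 2 * η / a * (1 / Real.sqrt n) ≤ 1 :=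
    (hδ.const_mul (2 * η / a)).eventually (eventually_le_nhds (by simp))
  have hδ2 : ∀ᶠ n : ℕ in atTop, K * A * (1 / Real.sqrt n) ≤ η * κ / 2 :=
    (hδ.const_mul (K * A)).eventually (eventually_le_nhds (by rw [mul_zero]; positivity))
  obtain ⟨C, hCdef⟩ : ∃ C, C = m * (η * (2 + A) + K * (A + A * (A + A / a))) := ⟨_, rfl⟩
  have hC : 0 < C := by
    rw [hCdef]
    positivity
  obtain ⟨N, hN⟩ := eventually_atTop.1 (hae.and (hbe.and (hBe.and (hA₁e.and (hA₂e.and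
    (hA₃e.and (hA₄e.and (hδ1.and (hδ2.and (eventually_ge_atTop 1))))))))))
  refine ⟨C * Real.exp (2 * η / a * (C / (η * κ / 4))), by positivity, η * κ / 4, by positivity,
    N, fun n hn x z hz => ?_⟩
  obtain ⟨e1, e2, e3, e4, e5, e6, e7, e8, e9, e10⟩ := hN n hn
  obtain ⟨imax, hmax⟩ := (hβmax n).1
  obtain ⟨imin, hmin⟩ := (hβmin n).1
  have hle : ∀ i, γN n i / μN n i ≤ βmaxN n := fun i => (hβmax n).2 ⟨i, rfl⟩
  have hge : ∀ i, βminN n ≤ γN n i / μN n i := fun i => (hβmin n).2 ⟨i, rfl⟩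
  have hmaxpos : 0 < βmaxN n := hmax ▸ div_pos (hγN n imax) (hμN n imax)
  have hmaxB : βmaxN n ≤ B := hmax ▸ e3 imax
  have hminb : b ≤ βminN n := hmin ▸ e2 imin
  obtain ⟨θ, hθdef⟩ : ∃ θ, θ = min 1 (max (1 - βminN n) (1/2) / βmaxN n) := ⟨_, rfl⟩
  have hcn : max (1 - βminN n) (1/2) ≤ c := by
    rw [hcdef]
    exact max_le_max (by linarith) le_rfl
  have hθ1 : θ ≤ 1 := hθdef ▸ min_le_left _ _
  have hκθ : κ ≤ θ := by
    rw [hκdef, hθdef]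
    refine (min_le_right _ _).trans (min_le_min le_rfl ?_)
    exact div_le_div₀ (le_max_of_le_right (by norm_num)) (le_max_right _ _) hmaxpos hmaxB
  have hθ0 : 0 ≤ θ := hκ.le.trans hκθ
  have hθβ : ∀ i, θ * (γN n i / μN n i) ≤ c := fun i => by
    have h : θ * βmaxN n ≤ max (1 - βminN n) (1/2) := by
      rw [← le_div_iff₀ hmaxpos, hθdef]
      exact min_le_right _ _
    exact (mul_le_mul_of_nonneg_left (hle i) hθ0).trans (h.trans hcn)
  simp only [← hθdef, bigPsi_add_eq_sum_lyapTerm]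
  refine (genN_exp_le hm e10 hη hθ1 hc0 ha (hlamN n) e1 (fun i => (e5 i).trans (by linarith))
    (hγN n) (fun i => (e6 i).trans (by linarith)) (fun i => (e4 i).trans (by linarith))
    ((e7 ()).trans (by linarith)) (fun i => ?_) hθβ hκ (hκdef ▸ min_le_left _ _) hκθ hK e8 e9
    hz).trans ?_
  · linarith [hge i, (le_max_left (1 - βminN n) (1/2)).trans hcn]
  rw [← hCdef, show η * κ / 2 = 2 * (η * κ / 4) by ring]
  refine exp_mul_sub_le hC.le (by positivity) (by positivity)
    (Finset.sum_nonneg fun i _ => abs_nonneg _) ?_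
  rw [norm1, Finset.mul_sum]
  refine Finset.sum_le_sum fun i _ => ?_
  refine (lyapTerm_le hη (hμN n i) hθ0 hθ1 _).trans ?_
  have := e1 i
  gcongr
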